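/- Let (λ_n)_{n≥1} be the sequence in F_q^* defined by recursion (1) with r = 2. Then (λ_n)_{n≥1} is ultimately periodic if and only if λ_m = (ε_1/ε_2) · ε_2^{((−1)^ℓ − (−1)^m)/2} for all 1 ≤ m ≤ ℓ. Moreover, when this condition holds, the sequence is purely periodic of period length at most 2, i.e., λ_{n+2} = λ_n for all n ≥ 1. -/

import Mathlib

lemma aux_odd_period {F : Type*} [Field F] (h2 : (2 : F) = 0) (ℓ : ℕ) (u : ℕ → F)
    (h1 : ∀ m, u (ℓ + 2 * m + 1) = u (m + 1) ^ 2)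
    (N d : ℕ) (hd : 1 ≤ d) (hp : ∀ n, N ≤ n → u (n + d) = u n) :
    ∃ N' d', d' % 2 = 1 ∧ ∀ n, N' ≤ n → u (n + d') = u n := by
  induction d using Nat.strong_induction_on generalizing N with
  | _ d ih =>
    rcases Nat.even_or_odd' d with ⟨e, rfl | rfl⟩
    · refine ih e (by omega) (N + 1) (by omega) ?_
      intro n hn
      obtain ⟨m, rfl⟩ : ∃ m, n = m + 1 := ⟨n - 1, by omega⟩
      have h := hp (ℓ + 2 * m + 1) (by omega)
      have e1 : ℓ + 2 * m + 1 + 2 * e = ℓ + 2 * (m + e) + 1 := by ring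
      rw [e1, h1, h1] at h
      have e2 : m + 1 + e = m + e + 1 := by ring
      rw [e2]
      have : (u (m + e + 1) - u (m + 1)) ^ 2 = 0 := by
        linear_combination h + (u (m + 1) ^ 2 - u (m + e + 1) * u (m + 1)) * h2
      exact sub_eq_zero.mp (pow_eq_zero_iff (two_ne_zero) |>.mp this)
    · exact ⟨N, 2 * e + 1, by omega, hp⟩

lemma aux_main {F : Type*} [Field F] (h2 : (2 : F) = 0) (ℓ : ℕ) (hℓ : 1 ≤ ℓ) (u : ℕ → F)
    (h1 : ∀ m, u (ℓ + 2 * m + 1) = u (m + 1) ^ 2)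
    (h0 : ∀ m, u (ℓ + 2 * m + 2) = 1)
    (N d : ℕ) (hd : 1 ≤ d) (hp : ∀ n, N ≤ n → u (n + d) = u n) :
    ∀ n, 1 ≤ n → u n = 1 := by
  obtain ⟨N', d', hd', hp'⟩ := aux_odd_period h2 ℓ u h1 N d hd hp
  have hev : ∀ n, ℓ + 2 ≤ n → n % 2 = ℓ % 2 → u n = 1 := by
    intro n hn hm
    obtain ⟨m, rfl⟩ : ∃ m, n = ℓ + 2 * m + 2 := ⟨(n - ℓ - 2) / 2, by omega⟩
    exact h0 m
  have hbig : ∀ n, N' + ℓ + 2 ≤ n → u n = 1 := by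
    intro n hn
    by_cases hm : n % 2 = ℓ % 2
    · exact hev n (by omega) hm
    · rw [← hp' n (by omega)]
      exact hev _ (by omega) (by omega)
  have key : ∀ K, (∀ n, K + 1 ≤ n → u n = 1) → ∀ n, 1 ≤ n → u n = 1 := by
    intro K
    induction K with
    | zero => intro h n hn; exact h n (by omega)
    | succ K ih =>
      intro h
      apply ih
      intro n hn
      rcases Nat.lt_or_ge n (K + 2) with hlt | hge
      · obtain rfl : n = K + 1 := by omega
        have h3 := h (ℓ + 2 * K + 1) (by omega)
        rw [h1] at h3
        have : (u (K + 1) - 1) ^ 2 = 0 := by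
          linear_combination h3 + (1 - u (K + 1)) * h2
        exact sub_eq_zero.mp (pow_eq_zero_iff (two_ne_zero) |>.mp this)
      · exact h n hge
  exact key (N' + ℓ + 1) hbig

/-- Proposition 3 of the paper. Let `(λ_n)_{n ≥ 1}` in `F_q^*` (with `q = 2^s`) be defined
by recursion (1) with `r = 2`: for all `m ≥ 0`,
`λ_{ℓ+2m+1} = (ε_2/ε_1) ε_2^((-1)^(m+1)) (λ_{m+1})^2` and `λ_{ℓ+2m+i} = (ε_1/ε_2)^((-1)^i)`
for `2 ≤ i ≤ 2`. Then `(λ_n)` is ultimately periodic if and only if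
`λ_m = (ε_1/ε_2) ε_2^(((-1)^ℓ - (-1)^m)/2)` for all `1 ≤ m ≤ ℓ`; moreover, when this
condition holds, the sequence is purely periodic of period length at most `2`, i.e.
`λ_{n+2} = λ_n` for all `n ≥ 1`. -/
theorem char_two_recurrence_periodicity {F : Type*} [Field F] [Fintype F]
    (s : ℕ) (hs : 1 ≤ s) (hcard : Fintype.card F = 2 ^ s)
    (r : ℕ) (hr : r = 2)
    (ℓ : ℕ) (hℓ : 1 ≤ ℓ)
    (lam : ℕ → F) (ε₁ ε₂ : F) (hε₁ : ε₁ ≠ 0) (hε₂ : ε₂ ≠ 0)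
    (hlam : ∀ n, 1 ≤ n → lam n ≠ 0)
    (hrec1 : ∀ m : ℕ,
      lam (ℓ + r * m + 1) = (ε₂ / ε₁) * ε₂ ^ ((-1 : ℤ) ^ (m + 1)) * (lam (m + 1)) ^ r)
    (hrec2 : ∀ m i : ℕ, 2 ≤ i → i ≤ r →
      lam (ℓ + r * m + i) = (ε₁ / ε₂) ^ ((-1 : ℤ) ^ i)) :
    ((∃ N : ℕ, 1 ≤ N ∧ ∃ d : ℕ, 1 ≤ d ∧ ∀ n, N ≤ n → lam (n + d) = lam n) ↔
      (∀ m, 1 ≤ m → m ≤ ℓ →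
        lam m = (ε₁ / ε₂) * ε₂ ^ (((-1 : ℤ) ^ ℓ - (-1 : ℤ) ^ m) / 2))) ∧
    ((∀ m, 1 ≤ m → m ≤ ℓ →
        lam m = (ε₁ / ε₂) * ε₂ ^ (((-1 : ℤ) ^ ℓ - (-1 : ℤ) ^ m) / 2)) →
      ∀ n, 1 ≤ n → lam (n + 2) = lam n) := by
  subst hr
  have h2 : (2 : F) = 0 := by
    have h := FiniteField.cast_card_eq_zero F
    rw [hcard] at h
    push_cast at h
    exact pow_eq_zero_iff (by omega) |>.mp h
  obtain ⟨c, hc⟩ : ∃ c : ℕ → F, ∀ m, c m = (ε₁ / ε₂) * ε₂ ^ (((-1 : ℤ) ^ ℓ - (-1 : ℤ) ^ m) / 2) :=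
    ⟨_, fun _ => rfl⟩
  have hc0 : ∀ m, c m ≠ 0 := by
    intro m
    rw [hc]
    exact mul_ne_zero (div_ne_zero hε₁ hε₂) (zpow_ne_zero _ hε₂)
  have hc2 : ∀ m, c (m + 2) = c m := by
    intro m
    rw [hc, hc, pow_add]
    norm_num
  have hc2k : ∀ k m, c (m + 2 * k) = c m := by
    intro k
    induction k with
    | zero => intro m; rfl
    | succ k ih => intro m; rw [show m + 2 * (k + 1) = (m + 2 * k) + 2 by ring, hc2, ih]
  have hcl : c ℓ = ε₁ / ε₂ := by rw [hc]; simp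
  have hcl1 : ∀ m, c (ℓ + 1) = (ε₂ / ε₁) * ε₂ ^ ((-1 : ℤ) ^ (m + 1)) * c (m + 1) ^ 2 := by
    intro m
    rw [hc, hc, pow_succ (-1 : ℤ) ℓ]
    rcases neg_one_pow_eq_or ℤ ℓ with h | h <;> rcases neg_one_pow_eq_or ℤ (m + 1) with h' | h' <;>
      rw [h, h'] <;> norm_num <;> field_simp
  have hu1 : ∀ m, lam (ℓ + 2 * m + 1) / c (ℓ + 2 * m + 1) = (lam (m + 1) / c (m + 1)) ^ 2 := by
    intro m
    have hz : ε₂ ^ ((-1 : ℤ) ^ (m + 1)) ≠ 0 := zpow_ne_zero _ hε₂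
    have h3 := hc0 (m + 1)
    rw [hrec1, show ℓ + 2 * m + 1 = ℓ + 1 + 2 * m by ring, hc2k, hcl1 m]
    generalize ε₂ ^ ((-1 : ℤ) ^ (m + 1)) = z at *
    field_simp
  have hu0 : ∀ m, lam (ℓ + 2 * m + 2) / c (ℓ + 2 * m + 2) = 1 := by
    intro m
    rw [hrec2 m 2 le_rfl le_rfl, hc2, hc2k, hcl]
    rw [show ((-1 : ℤ) ^ 2) = 1 by norm_num, zpow_one]
    exact div_self (div_ne_zero hε₁ hε₂)
  have hback : (∀ m, 1 ≤ m → m ≤ ℓ → lam m = c m) → ∀ n, 1 ≤ n → lam n = c n := by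
    intro h n
    induction n using Nat.strong_induction_on with
    | _ n ih =>
      intro hn
      rcases Nat.lt_or_ge ℓ n with hlt | hle
      · rw [← div_eq_one_iff_eq (hc0 n)]
        rcases Nat.even_or_odd' (n - ℓ - 1) with ⟨m, hm | hm⟩
        · obtain rfl : n = ℓ + 2 * m + 1 := by omega
          rw [hu1, ih (m + 1) (by omega) (by omega), div_self (hc0 _), one_pow]
        · obtain rfl : n = ℓ + 2 * m + 2 := by omega
          exact hu0 m
      · exact h n hn hle
  simp only [← hc]
  have hper : (∀ m, 1 ≤ m → m ≤ ℓ → lam m = c m) → ∀ n, 1 ≤ n → lam (n + 2) = lam n := by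
    intro h n hn
    rw [hback h _ hn, hback h _ (by omega), hc2]
  refine ⟨⟨?_, fun h => ⟨1, le_rfl, 2, by omega, hper h⟩⟩, hper⟩
  rintro ⟨N, hN, d, hd, hp⟩ m hm _
  rw [← div_eq_one_iff_eq (hc0 m)]
  refine aux_main h2 ℓ hℓ (fun n => lam n / c n) hu1 hu0 N (2 * d) (by omega) ?_ m hm
  intro n hn
  show lam (n + 2 * d) / c (n + 2 * d) = lam n / c n
  rw [hc2k, show n + 2 * d = n + d + d by ring, hp _ (by omega), hp _ hn]
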